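/- Let (A, L, ρ, [·,·]) be a Lie–Rinehart algebra over a commutative ℝ-algebra A, let n ≥ 1, let ω be a closed (n+1)-form on the base, and let J be an E-n-form compatible with ω, i.e., ᴱdJ = −ι_ρ^{n+1}ω. Then for every n-form λ on the base, the gauge-transformed form ω' := ω + dλ is again a closed (n+1)-form, and J' := J − (−1)^n ι_ρ^n λ is an E-n-form compatible with ω': ᴱdJ' = −ι_ρ^{n+1}ω'. -/

import Mathlib

open scoped BigOperators

section Defs

variable {A : Type*} [CommRing A] [Algebra ℝ A]

/-- The Lie algebroid (Chevalley–Eilenberg type) differential `ᴱd`, acting on raw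
`m`-cochains `(Fin m → L) → A`, for an anchor `ρ : L → Der_ℝ(A)` and a bracket `br`. -/
def ediff {L : Type*} (ρ : L → Derivation ℝ A A) (br : L → L → L) :
    ∀ m : ℕ, ((Fin m → L) → A) → (Fin (m + 1) → L) → A
  | 0, α => fun e => ∑ i : Fin 1, (-1 : A) ^ (i : ℕ) * ρ (e i) (α (e ∘ i.succAbove))
  | (m + 1), α => fun e =>
      (∑ i : Fin (m + 2), (-1 : A) ^ (i : ℕ) * ρ (e i) (α (e ∘ i.succAbove)))
        + ∑ i : Fin (m + 2), ∑ j : Fin (m + 1),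
            (if (i : ℕ) ≤ (j : ℕ) then
              (-1 : A) ^ ((i : ℕ) + (j : ℕ) + 1) *
                α (Fin.cons (br (e i) (e (i.succAbove j))) ((e ∘ i.succAbove) ∘ j.succAbove))
            else 0)

/-- Full contraction of a `k`-form on the base along the anchor, in reversed order:
`(ι_ρ^k ω)(e₁,…,e_k) = ω(ρ(e_k),…,ρ(e₁))`. -/
def contrFull {L : Type*} (ρ : L → Derivation ℝ A A) {k : ℕ}
    (ω : (Fin k → Derivation ℝ A A) → A) : (Fin k → L) → A :=
  fun e => ω fun i => ρ (e i.rev)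

/-- The interior product `ι_u`, with the convention that it vanishes on `0`-forms. -/
def iota {L : Type*} (u : L) : ∀ m : ℕ, ((Fin m → L) → A) → (Fin (m - 1) → L) → A
  | 0, _ => 0
  | (_ + 1), γ => fun e => γ (Fin.cons u e)

/-- The `E`-Lie derivative `ᴱL_u = ι_u ∘ ᴱd + ᴱd ∘ ι_u` (with `ι_u = 0` on `0`-forms). -/
def eLie {L : Type*} (ρ : L → Derivation ℝ A A) (br : L → L → L) (u : L) :
    ∀ m : ℕ, ((Fin m → L) → A) → (Fin m → L) → A
  | 0, α => show (Fin 0 → L) → A from iota u 1 (ediff ρ br 0 α)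
  | (m + 1), α =>
      (show (Fin (m + 1) → L) → A from iota u (m + 2) (ediff ρ br (m + 1) α))
        + ediff ρ br m (show (Fin m → L) → A from iota u (m + 1) α)

variable {L : Type*} [AddCommGroup L] [Module ℝ L] [Module A L] [IsScalarTower ℝ A L]

/-- `(A, L, ρ, br)` is a Lie–Rinehart algebra over the commutative `ℝ`-algebra `A`:
`br` is an `ℝ`-bilinear Lie bracket on `L`, the anchor `ρ` is `A`-linear, preserves
brackets, and the Leibniz rule holds. -/
structure IsLieRinehart (ρ : L →ₗ[A] Derivation ℝ A A) (br : L → L → L) : Prop where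
  add_left : ∀ x y z : L, br (x + y) z = br x z + br y z
  add_right : ∀ x y z : L, br x (y + z) = br x y + br x z
  smul_left : ∀ (r : ℝ) (x y : L), br (r • x) y = r • br x y
  smul_right : ∀ (r : ℝ) (x y : L), br x (r • y) = r • br x y
  antisymm : ∀ x y : L, br x y = - br y x
  jacobi : ∀ x y z : L, br (br x y) z + br (br y z) x + br (br z x) y = 0
  anchor_bracket : ∀ x y : L, ρ (br x y) = ⁅ρ x, ρ y⁆
  leibniz : ∀ (x : L) (a : A) (y : L), br x (a • y) = a • br x y + ρ x a • y

end Defs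

section Helpers

set_option linter.unusedSectionVars false
set_option linter.unusedSimpArgs false

variable {A : Type*} [CommRing A] [Algebra ℝ A]

local notation "VV" => Derivation ℝ A A

/-- insertion of a vector in the first slot -/
def insV {L : Type*} {m : ℕ} (u : L) (α : (Fin (m + 1) → L) → A) : (Fin m → L) → A :=
  fun e => α (Fin.cons u e)

/-- recursive Lie derivative -/
def lieR (u : Derivation ℝ A A) : ∀ m : ℕ, ((Fin m → Derivation ℝ A A) → A) →
    (Fin m → Derivation ℝ A A) → A
  | 0, α => fun e => u (α e)
  | (m + 1), α => fun e => lieR u m (insV (e 0) α) (Fin.tail e) - insV ⁅u, e 0⁆ α (Fin.tail e)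

/-- recursive differential -/
def dR : ∀ m : ℕ, ((Fin m → Derivation ℝ A A) → A) →
    (Fin (m + 1) → Derivation ℝ A A) → A
  | 0, α => fun e => lieR (e 0) 0 α (Fin.tail e)
  | (m + 1), α => fun e => lieR (e 0) (m + 1) α (Fin.tail e) - dR m (insV (e 0) α) (Fin.tail e)

/-- skew-symmetry -/
def Skw {L : Type*} : ∀ m : ℕ, ((Fin m → L) → A) → Prop
  | 0, _ => True
  | 1, _ => True
  | (m + 2), α => (∀ a b, insV b (insV a α) = - insV a (insV b α)) ∧ ∀ u, Skw (m + 1) (insV u α)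

/-- multi-additivity -/
def MAdd {L : Type*} [Add L] : ∀ m : ℕ, ((Fin m → L) → A) → Prop
  | 0, _ => True
  | (m + 1), α => (∀ a b, insV (a + b) α = insV a α + insV b α) ∧ ∀ u, MAdd m (insV u α)

theorem fun_ext_cons {L : Type*} {m : ℕ} {α β : (Fin (m + 1) → L) → A}
    (h : ∀ u, insV u α = insV u β) : α = β := by
  funext e
  have := congrFun (h (e 0)) (Fin.tail e)
  simpa [insV, Fin.cons_self_tail] using this

theorem insV_add {L : Type*} {m : ℕ} (u : L) (α β : (Fin (m + 1) → L) → A) :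
    insV u (α + β) = insV u α + insV u β := rfl
theorem insV_sub {L : Type*} {m : ℕ} (u : L) (α β : (Fin (m + 1) → L) → A) :
    insV u (α - β) = insV u α - insV u β := rfl
theorem insV_neg {L : Type*} {m : ℕ} (u : L) (α : (Fin (m + 1) → L) → A) :
    insV u (-α) = - insV u α := rfl
theorem insV_zero {L : Type*} {m : ℕ} (u : L) :
    insV u (0 : (Fin (m + 1) → L) → A) = 0 := rfl

theorem insV_lieR (u v : VV) (m : ℕ) (α : (Fin (m + 1) → VV) → A) :
    insV v (lieR u (m + 1) α) = lieR u m (insV v α) - insV ⁅u, v⁆ α := by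
  funext e
  simp [insV, lieR]

theorem insV_dR (v : VV) (m : ℕ) (α : (Fin (m + 1) → VV) → A) :
    insV v (dR (m + 1) α) = lieR v (m + 1) α - dR m (insV v α) := by
  funext e
  simp [insV, dR]

theorem insV_dR_zero (v : VV) (α : (Fin 0 → VV) → A) :
    insV v (dR 0 α) = lieR v 0 α := by
  funext e
  simp [insV, dR]

theorem lieR_sub (u : VV) (m : ℕ) (α β : (Fin m → VV) → A) :
    lieR u m (α - β) = lieR u m α - lieR u m β := by
  induction m with
  | zero => funext e; simp [lieR]
  | succ m ih =>
    apply fun_ext_cons; intro v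
    simp only [insV_sub, insV_lieR, ih]; abel

theorem dR_sub (m : ℕ) (α β : (Fin m → VV) → A) :
    dR m (α - β) = dR m α - dR m β := by
  induction m with
  | zero =>
    apply fun_ext_cons; intro v
    simp only [insV_sub, insV_dR_zero, lieR_sub]
  | succ m ih =>
    apply fun_ext_cons; intro v
    simp only [insV_sub, insV_dR, ih, lieR_sub]; abel

theorem dR_neg (m : ℕ) (α : (Fin m → VV) → A) : dR m (-α) = - dR m α := by
  have h0 : dR m (0 : (Fin m → VV) → A) = 0 := by
    have := dR_sub m (0 : (Fin m → VV) → A) 0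
    simpa using this
  have := dR_sub m 0 α
  simpa [h0] using this

theorem lieR_neg (u : VV) (m : ℕ) (α : (Fin m → VV) → A) : lieR u m (-α) = - lieR u m α := by
  have h0 : lieR u m (0 : (Fin m → VV) → A) = 0 := by
    have := lieR_sub u m (0 : (Fin m → VV) → A) 0
    simpa using this
  have := lieR_sub u m 0 α
  simpa [h0] using this

theorem MAdd.neg {L : Type*} [AddGroup L] {m : ℕ} {α : (Fin (m + 1) → L) → A}
    (h : MAdd (m + 1) α) (a : L) : insV (-a) α = - insV a α := by
  have h0 : insV (0 : L) α = 0 := by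
    have := h.1 0 0
    simpa using this
  have := h.1 (-a) a
  rw [neg_add_cancel, h0] at this
  exact eq_neg_of_add_eq_zero_left this.symm

theorem lieR_comm (u v : VV) (m : ℕ) (α : (Fin m → VV) → A) (h : MAdd m α) :
    lieR u m (lieR v m α) - lieR v m (lieR u m α) = lieR ⁅u, v⁆ m α := by
  induction m with
  | zero => funext e; simp [lieR, Derivation.commutator_apply]
  | succ m ih =>
    apply fun_ext_cons; intro w
    simp only [insV_sub, insV_lieR, lieR_sub]
    rw [← ih _ (h.2 w)]
    have e1 : insV ⁅u, ⁅v, w⁆⁆ α = insV ⁅⁅u, v⁆, w⁆ α + insV ⁅v, ⁅u, w⁆⁆ α := by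
      rw [← h.1, leibniz_lie]
    rw [e1]; abel

theorem lieR_dR (u : VV) (m : ℕ) (α : (Fin m → VV) → A) (h : MAdd m α) :
    lieR u (m + 1) (dR m α) = dR m (lieR u m α) := by
  induction m with
  | zero =>
    apply fun_ext_cons; intro v
    simp only [insV_lieR, insV_dR_zero]
    rw [← lieR_comm u v 0 α h]; abel
  | succ m ih =>
    apply fun_ext_cons; intro v
    simp only [insV_lieR, insV_dR, lieR_sub, dR_sub, ih _ (h.2 v)]
    rw [← lieR_comm u v _ α h]; abel

theorem dR_dR (m : ℕ) (α : (Fin m → VV) → A) (h : MAdd m α) :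
    dR (m + 1) (dR m α) = 0 := by
  induction m with
  | zero =>
    apply fun_ext_cons; intro v
    simp only [insV_dR, insV_dR_zero, lieR_dR _ _ _ h, insV_zero, sub_self]
  | succ m ih =>
    apply fun_ext_cons; intro v
    simp only [insV_dR, lieR_dR _ _ _ h, insV_zero, dR_sub, ih _ (h.2 v)]
    abel

theorem Skw.ins {L : Type*} {m : ℕ} {α : (Fin (m + 1) → L) → A} (h : Skw (m + 1) α) (u : L) :
    Skw m (insV u α) := by
  cases m with
  | zero => trivial
  | succ m => exact h.2 u

theorem Skw.sub {L : Type*} {m : ℕ} {α β : (Fin m → L) → A} (h : Skw m α) (h' : Skw m β) :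
    Skw m (α - β) := by
  induction m with
  | zero => trivial
  | succ m ih =>
    cases m with
    | zero => trivial
    | succ m =>
      refine ⟨fun a b => ?_, fun u => ?_⟩
      · simp only [insV_sub, h.1 a b, h'.1 a b]; abel
      · exact ih (h.2 u) (h'.2 u)

theorem Skw.lieR {m : ℕ} {α : (Fin m → VV) → A} (h : Skw m α) (u : VV) :
    Skw m (lieR u m α) := by
  induction m with
  | zero => trivial
  | succ m ih =>
    cases m with
    | zero => trivial
    | succ m =>
      refine ⟨fun a b => ?_, fun v => ?_⟩
      · simp only [insV_lieR, insV_sub, h.1 a b, h.1 a ⁅u, b⁆, h.1 ⁅u, a⁆ b, lieR_neg]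
        abel
      · rw [insV_lieR]
        exact (ih (h.2 v)).sub (h.2 _)

theorem Skw.dR {m : ℕ} {α : (Fin m → VV) → A} (h : Skw m α) (h' : MAdd m α) :
    Skw (m + 1) (dR m α) := by
  induction m with
  | zero => trivial
  | succ m ih =>
    refine ⟨fun a b => ?_, fun v => ?_⟩
    · have e1 : insV ⁅a, b⁆ α = - insV ⁅b, a⁆ α := by rw [← h'.neg, lie_skew]
      cases m with
      | zero =>
        simp only [insV_dR, insV_sub, insV_lieR, insV_dR_zero, e1]; abel
      | succ m =>
        simp only [insV_dR, insV_sub, insV_lieR, e1, h.1 a b, dR_neg]; abel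
    · rw [insV_dR]
      exact (h.lieR v).sub (ih (h.ins v) (h'.2 v))

theorem cons_comp_succ {L : Type*} {m : ℕ} (w : L) (e : Fin (m + 1) → L) (j : Fin (m + 1)) :
    (Fin.cons w e : Fin (m + 2) → L) ∘ j.succ.succAbove = Fin.cons w (e ∘ j.succAbove) := by
  funext k
  refine Fin.cases ?_ (fun k => ?_) k <;> simp

theorem cons_comp_zero {L : Type*} {m : ℕ} (w : L) (e : Fin m → L) :
    (Fin.cons w e : Fin (m + 1) → L) ∘ (0 : Fin (m + 1)).succAbove = e := by
  funext k
  simp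

theorem lieR_eq (u : VV) (m : ℕ) (α : (Fin (m + 1) → VV) → A) (h : Skw (m + 1) α)
    (e : Fin (m + 1) → VV) :
    lieR u (m + 1) α e = u (α e) + ∑ j : Fin (m + 1),
      (-1 : A) ^ ((j : ℕ) + 1) * α (Fin.cons ⁅u, e j⁆ (e ∘ j.succAbove)) := by
  induction m with
  | zero =>
    refine Fin.consCases (fun w e => ?_) e
    have := congrFun (insV_lieR u w _ α) e
    simp only [insV] at this
    rw [this]
    simp [lieR, insV, sub_eq_add_neg, cons_comp_zero]
  | succ m ih =>
    refine Fin.consCases (fun w e => ?_) e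
    have := congrFun (insV_lieR u w _ α) e
    simp only [insV, Pi.sub_apply] at this
    rw [this]
    have := ih (insV w α) (h.2 w) e
    simp only [insV] at this
    rw [this, Fin.sum_univ_succ (n := m + 1)]
    simp only [Fin.cons_zero, Fin.cons_succ, cons_comp_zero, cons_comp_succ, Fin.val_zero,
      Fin.val_succ]
    have e1 : ∀ j : Fin (m + 1),
      α (Fin.cons ⁅u, e j⁆ (Fin.cons w (e ∘ j.succAbove)))
        = - α (Fin.cons w (Fin.cons ⁅u, e j⁆ (e ∘ j.succAbove))) := fun j => by
      have := congrFun (h.1 ⁅u, e j⁆ w) (e ∘ j.succAbove)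
      simpa [insV] using this
    simp only [e1]
    have e2 : ∀ j : Fin (m + 1), ∀ x : A, (-1 : A) ^ ((j : ℕ) + 1 + 1) * -x =
      (-1 : A) ^ ((j : ℕ) + 1) * x := fun j x => by ring
    simp only [e2]
    ring

local notation "dd" => ediff (fun D : Derivation ℝ A A => D) (fun D₁ D₂ => ⁅D₁, D₂⁆)

theorem ediff_eq_dR (m : ℕ) (α : (Fin m → VV) → A) (h : Skw m α) : dd m α = dR m α := by
  induction m with
  | zero =>
    apply fun_ext_cons; intro v
    rw [insV_dR_zero]
    funext e
    simp [insV, ediff, lieR, cons_comp_zero]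
  | succ m ih =>
    apply fun_ext_cons; intro v
    rw [insV_dR, ← ih _ (h.ins v)]
    funext e
    rw [Pi.sub_apply, lieR_eq _ _ _ h]
    simp only [insV, ediff]
    rw [Fin.sum_univ_succ (n := m + 1), Fin.sum_univ_succ (n := m + 1)]
    simp only [Fin.cons_zero, Fin.cons_succ, cons_comp_zero, cons_comp_succ, Fin.val_zero,
      Fin.val_succ, Fin.zero_succAbove, pow_zero, one_mul, zero_le, if_true, zero_add]
    cases m with
    | zero =>
      simp [ediff, insV]
      ring
    | succ m =>
      simp only [ediff, insV]
      have e1 : ∀ i : Fin (m + 2), (∑ j : Fin (m + 2), if (i : ℕ) + 1 ≤ (j : ℕ) then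
          (-1 : A) ^ ((i : ℕ) + 1 + (j : ℕ) + 1) *
            α (Fin.cons ⁅e i, (Fin.cons v e : Fin (m + 3) → VV) (i.succ.succAbove j)⁆
              ((Fin.cons v (e ∘ i.succAbove) : Fin (m + 2) → VV) ∘ j.succAbove)) else 0)
          = - ∑ j : Fin (m + 1), if (i : ℕ) ≤ (j : ℕ) then
          (-1 : A) ^ ((i : ℕ) + (j : ℕ) + 1) *
            α (Fin.cons v (Fin.cons ⁅e i, e (i.succAbove j)⁆
              ((e ∘ i.succAbove) ∘ j.succAbove))) else 0 := by
        intro i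
        have hz : ¬ ((i : ℕ) + 1 ≤ ((0 : Fin (m + 2)) : ℕ)) := by simp
        rw [Fin.sum_univ_succ, ← Finset.sum_neg_distrib, if_neg hz, zero_add]
        simp only [Fin.val_succ, Fin.succ_succAbove_succ, Fin.cons_succ,
          cons_comp_succ, Nat.add_le_add_iff_right]
        refine Finset.sum_congr rfl fun j _ => ?_
        split_ifs
        · have := congrFun (h.1 ⁅e i, e (i.succAbove j)⁆ v) ((e ∘ i.succAbove) ∘ j.succAbove)
          simp only [insV, Pi.neg_apply] at this
          rw [this]; ring
        · simp
      simp only [e1, Finset.sum_neg_distrib]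
      have e2 : ∀ (k : ℕ) (x : A), (-1 : A) ^ (k + 1) * x = - ((-1 : A) ^ k * x) :=
        fun k x => by ring
      simp only [e2, Finset.sum_neg_distrib]
      ring

theorem skw_alt {L : Type*} [AddCommGroup L] [Module A L] (m : ℕ)
    (α : AlternatingMap A L A (Fin m)) : Skw m ⇑α := by
  induction m with
  | zero => trivial
  | succ m ih =>
    cases m with
    | zero => trivial
    | succ m =>
      refine ⟨fun a b => ?_, fun u => ih (α.curryLeft u)⟩
      funext e
      have := α.map_swap (Fin.cons b (Fin.cons a e)) (i := 0) (j := 1) (by simp)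
      simp only [insV, Pi.neg_apply]
      rw [← this]
      congr 1
      funext k
      refine Fin.cases ?_ (fun k => ?_) k
      · simp
      · refine Fin.cases ?_ (fun k => ?_) k
        · simp
        · have : Equiv.swap (0 : Fin (m + 2)) 1 k.succ.succ = k.succ.succ :=
            Equiv.swap_apply_of_ne_of_ne (Fin.succ_ne_zero _)
              (fun h => Fin.succ_ne_zero k (Fin.succ_injective _ h))
          simp [this]

theorem madd_alt {L : Type*} [AddCommGroup L] [Module A L] (m : ℕ)
    (α : AlternatingMap A L A (Fin m)) : MAdd m ⇑α := by
  induction m with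
  | zero => trivial
  | succ m ih =>
    refine ⟨fun a b => ?_, fun u => ih (α.curryLeft u)⟩
    funext e
    have := congrArg (fun f => f e) (α.curryLeft.map_add a b)
    exact this

theorem Skw.snoc {L : Type*} {m : ℕ} {α : (Fin (m + 1) → L) → A} (h : Skw (m + 1) α)
    (e : Fin m → L) (x : L) :
    α (Fin.snoc (α := fun _ => L) e x) = (-1 : A) ^ m * α (Fin.cons x e) := by
  induction m with
  | zero =>
    simp only [pow_zero, one_mul]
    congr 1
    funext k
    have : k = Fin.last 0 := Fin.ext (by simp)
    subst this
    simp only [Fin.snoc_last]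
    rfl
  | succ m ih =>
    revert e
    refine Fin.consCases (fun w e => ?_)
    have h1 := ih (h.2 w) e
    have h2 := congrFun (h.1 x w) e
    simp only [insV, Pi.neg_apply] at h1 h2
    rw [← Fin.cons_snoc_eq_snoc_cons, h1, h2]
    ring

/-- sign of the reversal -/
def revS (A : Type*) [CommRing A] : ℕ → A
  | 0 => 1
  | m + 1 => (-1) ^ m * revS A m

theorem Skw.rev {L : Type*} {m : ℕ} {α : (Fin m → L) → A} (h : Skw m α) (e : Fin m → L) :
    α (fun i => e i.rev) = revS A m * α e := by
  induction m with
  | zero =>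
    simp only [revS, one_mul]
    congr 1
    funext k
    exact k.elim0
  | succ m ih =>
    revert e
    refine Fin.consCases (fun w e => ?_)
    have e1 : (fun i : Fin (m + 1) => (Fin.cons w e : Fin (m + 1) → L) i.rev)
        = Fin.snoc (α := fun _ => L) (fun i => e i.rev) w := by
      funext k
      refine Fin.lastCases ?_ (fun k => ?_) k
      · simp
      · simp [Fin.rev_castSucc]
    rw [e1, h.snoc]
    have := ih (h.ins w) e
    simp only [insV] at this
    rw [this, revS]; ring

theorem ediff_add {L : Type*} (ρ : L → VV) (br : L → L → L) (m : ℕ)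
    (α β : (Fin m → L) → A) : ediff ρ br m (α + β) = ediff ρ br m α + ediff ρ br m β := by
  funext e
  cases m with
  | zero => simp [ediff]
  | succ m =>
    have e1 : ∀ (p : Prop) [Decidable p] (y z : A), (if p then y + z else 0)
        = (if p then y else 0) + (if p then z else 0) := by
      intro p _ y z; split_ifs <;> simp
    simp only [ediff, Pi.add_apply, map_add, e1, mul_add, Finset.sum_add_distrib]
    ring

theorem ediff_const {L : Type*} (ρ : L → VV) (br : L → L → L) (m : ℕ) (c : A)
    (hc : ∀ D : VV, D c = 0)
    (α : (Fin m → L) → A) : ediff ρ br m (c • α) = c • ediff ρ br m α := by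
  funext e
  cases m with
  | zero => simp [ediff, hc]
  | succ m =>
    simp only [ediff, Pi.smul_apply, smul_eq_mul, Derivation.leibniz, hc, mul_add, mul_zero,
      add_zero, Finset.mul_sum, mul_ite]
    congr 1
    · exact Finset.sum_congr rfl fun i _ => by ring
    · refine Finset.sum_congr rfl fun i _ => Finset.sum_congr rfl fun j _ => ?_
      split_ifs <;> ring

theorem ediff_pull {L : Type*} (ρ : L → VV) (br : L → L → L)
    (h : ∀ x y, ρ (br x y) = ⁅ρ x, ρ y⁆) (m : ℕ)
    (α : (Fin m → VV) → A) : ediff ρ br m (fun e => α (ρ ∘ e)) = fun e => dd m α (ρ ∘ e) := by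
  funext e
  cases m with
  | zero => simp only [ediff]; rfl
  | succ m =>
    have e1 : ∀ (x : L) (f : Fin m → L), ρ ∘ (Fin.cons x f : Fin (m + 1) → L)
        = Fin.cons (ρ x) (ρ ∘ f) := by
      intro x f; funext k
      refine Fin.cases ?_ (fun k => ?_) k <;> simp
    simp only [ediff, e1, h]
    rfl

theorem neg_one_const (D : VV) (k : ℕ) : D ((-1 : A) ^ k) = 0 := by
  rcases neg_one_pow_eq_or A k with h | h <;> simp [h]

theorem revS_const (D : VV) (k : ℕ) : D (revS A k) = 0 := by
  induction k with
  | zero => simp [revS]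
  | succ k ih => simp [revS, ih, neg_one_const]

end Helpers

section Statements

variable {A : Type*} [CommRing A] [Algebra ℝ A]
variable {L : Type*} [AddCommGroup L] [Module ℝ L] [Module A L] [IsScalarTower ℝ A L]

/-- (Gauge transformations.) Let `(A, L, ρ, br)` be a Lie–Rinehart
algebra, `n ≥ 1`, `ω` a closed `(n+1)`-form on the base, and `J` an `E`-`n`-form
compatible with `ω`, i.e. `ᴱd J = - ι_ρ^{n+1} ω`.  Then for every `n`-form `λ` on the
base, `ω' := ω + dλ` is again closed, and `J' := J - (-1)^n ι_ρ^n λ` is compatible with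
`ω'`:  `ᴱd J' = - ι_ρ^{n+1} ω'`. -/
theorem gauge_transformation_compatible (ρ : L →ₗ[A] Derivation ℝ A A) (br : L → L → L)
    (hLR : IsLieRinehart ρ br) (n : ℕ) (hn : 1 ≤ n)
    (ω : AlternatingMap A (Derivation ℝ A A) A (Fin (n + 1)))
    (hω : ediff (fun D : Derivation ℝ A A => D) (fun D₁ D₂ => ⁅D₁, D₂⁆) (n + 1) ⇑ω = 0)
    (J : AlternatingMap A L A (Fin n))
    (hJ : ediff (⇑ρ) br n ⇑J = - contrFull (⇑ρ) ⇑ω)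
    (lam : AlternatingMap A (Derivation ℝ A A) A (Fin n)) :
    (ediff (fun D : Derivation ℝ A A => D) (fun D₁ D₂ => ⁅D₁, D₂⁆) (n + 1)
        (⇑ω + ediff (fun D : Derivation ℝ A A => D) (fun D₁ D₂ => ⁅D₁, D₂⁆) n ⇑lam) = 0)
    ∧ (ediff (⇑ρ) br n (⇑J - (-1 : A) ^ n • contrFull (⇑ρ) ⇑lam)
        = - contrFull (⇑ρ)
            (⇑ω + ediff (fun D : Derivation ℝ A A => D) (fun D₁ D₂ => ⁅D₁, D₂⁆) n ⇑lam)) := by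
  have hs := skw_alt n lam
  have hm := madd_alt n lam
  have hd := ediff_eq_dR n _ hs
  have hsd : Skw (n + 1) (dR n ⇑lam) := hs.dR hm
  refine ⟨?_, ?_⟩
  · rw [ediff_add, hω, hd, ediff_eq_dR _ _ hsd, dR_dR _ _ hm, add_zero]
  · have hc : contrFull (⇑ρ) ⇑lam = revS A n • (fun e => lam (⇑ρ ∘ e)) := by
      funext e
      exact hs.rev (⇑ρ ∘ e)
    have hneg : ⇑J - (-1 : A) ^ n • contrFull (⇑ρ) ⇑lam
        = ⇑J + (-1 : A) ^ (n + 1) • contrFull (⇑ρ) ⇑lam := by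
      rw [pow_succ, mul_neg_one, neg_smul, sub_eq_add_neg]
    rw [hneg, ediff_add, ediff_const _ _ _ _ (fun D => neg_one_const D _), hc,
      ediff_const _ _ _ _ (fun D => revS_const D _), ediff_pull _ _ hLR.anchor_bracket, hJ, hd]
    funext e
    have := hsd.rev (⇑ρ ∘ e)
    simp only [Function.comp_apply, revS] at this
    simp only [contrFull, Pi.add_apply, Pi.neg_apply, Pi.smul_apply, smul_eq_mul]
    rw [this, pow_succ]
    have e2 : (⇑ρ ∘ e) = fun i => ρ (e i) := rfl
    rw [e2]
    ring


end Statements
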